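/- Let d < 0 be squarefree with d ≡ 5 (mod 8), let O_d be the ring of integers of ℚ(√d), and B_d = PSL(2, O_d). Then the commutator subgroup [B_d, B_d] and the power subgroup B_d² = ⟨x² : x ∈ B_d⟩ are non-congruence subgroups of B_d if and only if d ≠ −3. -/

import Mathlib

set_option linter.unusedSectionVars false

open NumberField Matrix

instance : Fact (Even (Fintype.card (Fin 2))) := ⟨⟨1, rfl⟩⟩

variable (K : Type*) [Field K] [NumberField K]

/-- The subgroup `{±I}` of `SL(2, 𝓞)`, generated by `-I`. -/
def PM : Subgroup (Matrix.SpecialLinearGroup (Fin 2) (𝓞 K)) :=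
  Subgroup.closure {(-1 : Matrix.SpecialLinearGroup (Fin 2) (𝓞 K))}

theorem PM_le_center : PM K ≤ Subgroup.center (Matrix.SpecialLinearGroup (Fin 2) (𝓞 K)) := by
  rw [PM, Subgroup.closure_le]
  rintro x rfl
  rw [SetLike.mem_coe, Subgroup.mem_center_iff]
  intro g
  ext i j
  simp [Matrix.SpecialLinearGroup.coe_mul]

instance PM_normal : (PM K).Normal := by
  constructor
  intro n hn g
  have hc := PM_le_center K hn
  rw [Subgroup.mem_center_iff] at hc
  rw [hc g, mul_assoc, mul_inv_cancel, mul_one]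
  exact hn

/-- `PSL(2, 𝓞)`, the quotient of `SL(2, 𝓞)` by `{±I}`. -/
def PSL := Matrix.SpecialLinearGroup (Fin 2) (𝓞 K) ⧸ PM K

instance : Group (PSL K) := QuotientGroup.Quotient.group (PM K)

/-- The projection `SL(2, 𝓞) → PSL(2, 𝓞)`. -/
def proj : Matrix.SpecialLinearGroup (Fin 2) (𝓞 K) →* PSL K :=
  QuotientGroup.mk' (PM K)

/-- The elementary matrix `T_x = [[1, x], [0, 1]]` in `SL(2, 𝓞)`. -/
def T (x : 𝓞 K) : Matrix.SpecialLinearGroup (Fin 2) (𝓞 K) :=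
  ⟨!![1, x; 0, 1], by simp [Matrix.det_fin_two_of]⟩

/-- The reduction homomorphism `SL(2, 𝓞) → SL(2, 𝓞/π)`. -/
def red (π : Ideal (𝓞 K)) :
    Matrix.SpecialLinearGroup (Fin 2) (𝓞 K) →*
      Matrix.SpecialLinearGroup (Fin 2) ((𝓞 K) ⧸ π) :=
  Matrix.SpecialLinearGroup.map (Ideal.Quotient.mk π)

/-- The principal congruence subgroup `Ḡ(π)` of `PSL(2,𝓞)` : the image in `PSL(2,𝓞)` of
`{A ∈ SL(2,𝓞) : A ≡ ±I (mod π)}`, the set of matrices reducing to `±I` modulo `π`. -/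
def Gbar (π : Ideal (𝓞 K)) : Subgroup (PSL K) :=
  Subgroup.map (proj K)
    (Subgroup.comap (red K π)
      (Subgroup.closure {(-1 : Matrix.SpecialLinearGroup (Fin 2) ((𝓞 K) ⧸ π))}))

/-- A subgroup of `G = PSL(2,𝓞)` is a congruence subgroup if it contains `Ḡ(π)` for some
nonzero ideal `π` of `𝓞`. -/
def IsCongruence (H : Subgroup (PSL K)) : Prop :=
  ∃ π : Ideal (𝓞 K), π ≠ ⊥ ∧ Gbar K π ≤ H

/-- The normal closure in `PSL(2,𝓞)` of the images of the matrices `T_{mx}`, `x ∈ 𝓞`. -/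
def TclosureP (m : ℕ) : Subgroup (PSL K) :=
  Subgroup.normalClosure {x : PSL K | ∃ a : 𝓞 K, x = proj K (T K ((m : 𝓞 K) * a))}

/-- `H ≤ PSL(2,𝓞)` has level `m` : `m` is the smallest positive integer such that the
normal closure in `PSL(2,𝓞)` of the images of `{T_{mx} : x ∈ 𝓞}` is contained in `H`. -/
def HasLevelP (H : Subgroup (PSL K)) (m : ℕ) : Prop :=
  0 < m ∧ TclosureP K m ≤ H ∧ ∀ k : ℕ, 0 < k → TclosureP K k ≤ H → m ≤ k

/-- The subgroup of a group `G` generated by all squares `x²`, `x ∈ G`. -/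
def sqSubgroup (G : Type*) [Group G] : Subgroup G :=
  Subgroup.closure {x : G | ∃ y : G, x = y ^ 2}

theorem ncard_symmDiff_cast {α : Type*} {S T : Set α} (hS : S.Finite) (hT : T.Finite) :
    ((symmDiff S T).ncard : ZMod 2) = S.ncard + T.ncard := by
  have h1 := Set.ncard_inter_add_ncard_sdiff_eq_ncard S T hS
  have h2 := Set.ncard_inter_add_ncard_sdiff_eq_ncard T S hT
  have h3 : (symmDiff S T).ncard = (S \ T).ncard + (T \ S).ncard := by
    rw [Set.symmDiff_def]
    exact Set.ncard_union_eq disjoint_sdiff_sdiff hS.sdiff hT.sdiff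
  rw [h3, ← h1, ← h2, Set.inter_comm T S]
  push_cast
  have : (2 : ZMod 2) = 0 := rfl
  linear_combination (-((S ∩ T).ncard : ZMod 2)) * this

/-- The parity character of a group action attached to a commensurated subset. -/
theorem exists_parity_character {G α : Type*} [Group G] (ρ : G →* Equiv.Perm α) (A : Set α)
    (hA : ∀ g, {x | x ∈ A ∧ ρ g x ∉ A}.Finite) :
    ∃ χ : G →* Multiplicative (ZMod 2), ∀ g,
      χ g = Multiplicative.ofAdd ((symmDiff (ρ g ⁻¹' A) A).ncard : ZMod 2) := by
  have hfin : ∀ g, (symmDiff (ρ g ⁻¹' A) A).Finite := by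
    intro g
    rw [Set.symmDiff_def]
    refine Set.Finite.union ?_ ((hA g).subset fun x hx => ⟨hx.1, hx.2⟩)
    refine ((hA g⁻¹).image (ρ g⁻¹)).subset ?_
    rintro x ⟨hx, hxA⟩
    refine ⟨ρ g x, ⟨hx, ?_⟩, ?_⟩ <;> simp [← Equiv.Perm.mul_apply, hxA]
  refine ⟨MonoidHom.mk' (fun g => Multiplicative.ofAdd _) fun g h => ?_, fun g => rfl⟩
  rw [← ofAdd_add]
  congr 1
  have h1 : symmDiff (ρ (g * h) ⁻¹' A) A =
      symmDiff (ρ h ⁻¹' (symmDiff (ρ g ⁻¹' A) A)) (symmDiff (ρ h ⁻¹' A) A) := by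
    ext x
    simp only [Set.mem_symmDiff, Set.mem_preimage, map_mul, Equiv.Perm.mul_apply]
    tauto
  rw [h1, ncard_symmDiff_cast ((hfin g).preimage (ρ h).injective.injOn) (hfin h)]
  congr 2
  exact Set.ncard_preimage_of_injective_subset_range (ρ h).injective
    (by simp [(ρ h).surjective.range_eq])

/-- The twisted conjugation action `h • x = h x σ(h)⁻¹` of a group with endomorphism `σ`. -/
def twistedConj {G : Type*} [Group G] (σ : G →* G) : G →* Equiv.Perm G where
  toFun h := (Equiv.mulLeft h).trans (Equiv.mulRight (σ h)⁻¹)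
  map_one' := by ext; simp
  map_mul' a b := by ext; simp [mul_assoc]

theorem twistedConj_apply {G : Type*} [Group G] (σ : G →* G) (h x : G) :
    twistedConj σ h x = h * x * (σ h)⁻¹ := rfl

theorem twistedConj_mem_range {G : Type*} [Group G] (σ : G →* G) (h : G) {x : G}
    (hx : ∃ g, x = g * (σ g)⁻¹) : ∃ g, twistedConj σ h x = g * (σ g)⁻¹ := by
  obtain ⟨g, rfl⟩ := hx
  exact ⟨h * g, by simp [twistedConj_apply, mul_assoc]⟩

section Commutator

open scoped commutatorElement

theorem commutatorElement_eq_mul_sq {G : Type*} [Group G] (a b : G) :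
    ⁅a, b⁆ = a ^ 2 * (a⁻¹ * b) ^ 2 * (b⁻¹) ^ 2 := by
  simp only [commutatorElement_def, pow_two]
  group

end Commutator

section SL2

variable {R : Type*} [CommRing R]

theorem sl2_mul_apply (A B : SpecialLinearGroup (Fin 2) R) (i j : Fin 2) :
    (A * B) i j = A i 0 * B 0 j + A i 1 * B 1 j := by
  change (A.1 * B.1) i j = _
  rw [Matrix.mul_apply, Fin.sum_univ_two]

theorem sl2_inv_apply_zero_zero (A : SpecialLinearGroup (Fin 2) R) : A⁻¹ 0 0 = A 1 1 := by
  change A.1.adjugate 0 0 = _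
  simp [adjugate_fin_two]

theorem sl2_inv_apply_zero_one (A : SpecialLinearGroup (Fin 2) R) : A⁻¹ 0 1 = -A 0 1 := by
  change A.1.adjugate 0 1 = _
  simp [adjugate_fin_two]

theorem sl2_inv_apply_one_zero (A : SpecialLinearGroup (Fin 2) R) : A⁻¹ 1 0 = -A 1 0 := by
  change A.1.adjugate 1 0 = _
  simp [adjugate_fin_two]

theorem sl2_inv_apply_one_one (A : SpecialLinearGroup (Fin 2) R) : A⁻¹ 1 1 = A 0 0 := by
  change A.1.adjugate 1 1 = _
  simp [adjugate_fin_two]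

theorem sl2_det_eq (A : SpecialLinearGroup (Fin 2) R) : A 0 0 * A 1 1 - A 0 1 * A 1 0 = 1 := by
  rw [← det_fin_two]
  exact A.2

theorem sl2_ext {A B : SpecialLinearGroup (Fin 2) R} (h00 : A 0 0 = B 0 0) (h01 : A 0 1 = B 0 1)
    (h10 : A 1 0 = B 1 0) (h11 : A 1 1 = B 1 1) : A = B := by
  ext i j
  fin_cases i <;> fin_cases j <;> assumption

/-- The matrix `[[a, b], [c, d]]` of determinant one. -/
def sl2Mk (a b c d : R) (h : a * d - b * c = 1) : SpecialLinearGroup (Fin 2) R :=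
  ⟨!![a, b; c, d], by rw [det_fin_two_of, h]⟩

variable {a b c d : R} (h : a * d - b * c = 1)

@[simp] theorem sl2Mk_zero_zero : sl2Mk a b c d h 0 0 = a := rfl

@[simp] theorem sl2Mk_zero_one : sl2Mk a b c d h 0 1 = b := rfl

@[simp] theorem sl2Mk_one_zero : sl2Mk a b c d h 1 0 = c := rfl

@[simp] theorem sl2Mk_one_one : sl2Mk a b c d h 1 1 = d := rfl

/-- The unipotent matrix `[[1, x], [0, 1]]`. -/
def upperUnipotent (x : R) : SpecialLinearGroup (Fin 2) R :=
  sl2Mk 1 x 0 1 (by simp)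

theorem upperUnipotent_add (x y : R) :
    upperUnipotent (x + y) = upperUnipotent x * upperUnipotent y := by
  apply sl2_ext <;> simp [upperUnipotent, sl2_mul_apply, add_comm]

theorem upperUnipotent_zero : upperUnipotent (0 : R) = 1 := by
  apply sl2_ext <;> simp [upperUnipotent]

theorem upperUnipotent_neg (x : R) : upperUnipotent (-x) = (upperUnipotent x)⁻¹ := by
  rw [eq_inv_iff_mul_eq_one, ← upperUnipotent_add, neg_add_cancel, upperUnipotent_zero]

/-- The unipotent matrix `[[1, 0], [x, 1]]`. -/
def lowerUnipotent (x : R) : SpecialLinearGroup (Fin 2) R :=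
  sl2Mk 1 0 x 1 (by simp)

variable (R) in
/-- The matrix `[[0, -1], [1, 0]]`. -/
def weylElement : SpecialLinearGroup (Fin 2) R :=
  sl2Mk 0 (-1) 1 0 (by simp)

theorem weylElement_mul_upperUnipotent (x : R) :
    weylElement R * upperUnipotent (-x) * (weylElement R)⁻¹ = lowerUnipotent x := by
  rw [mul_inv_eq_iff_eq_mul]
  apply sl2_ext <;> simp [weylElement, upperUnipotent, lowerUnipotent, sl2_mul_apply]

variable (R) in
theorem weylElement_eq :
    weylElement R = upperUnipotent (-1) * lowerUnipotent 1 * upperUnipotent (-1) := by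
  apply sl2_ext <;> simp [weylElement, upperUnipotent, lowerUnipotent, sl2_mul_apply]

end SL2

/-- The order `ℤ[ω]` with `ω² = ω + e`, of discriminant `1 + 4e`. -/
abbrev QuadOrder (e : ℤ) := QuadraticAlgebra ℤ e 1

namespace QuadOrder

open scoped QuadraticAlgebra commutatorElement

variable {e : ℤ}

/-- The square root `2ω - 1` of the discriminant `1 + 4e`. -/
def sqrtDisc (e : ℤ) : QuadOrder e := ⟨-1, 2⟩

/-- Entrywise conjugation on `SL(2, ℤ[ω])`. -/
def conj : SpecialLinearGroup (Fin 2) (QuadOrder e) →* SpecialLinearGroup (Fin 2) (QuadOrder e) :=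
  SpecialLinearGroup.map (starRingEnd (QuadOrder e))

theorem conj_apply (g : SpecialLinearGroup (Fin 2) (QuadOrder e)) (i j : Fin 2) :
    conj g i j = star (g i j) := rfl

theorem twistedConj_conj_apply_zero_one (h X : SpecialLinearGroup (Fin 2) (QuadOrder e)) :
    twistedConj conj h X 0 1 = (h 0 0 * X 0 1 + h 0 1 * X 1 1) * star (h 0 0) -
      (h 0 0 * X 0 0 + h 0 1 * X 1 0) * star (h 0 1) := by
  simp only [twistedConj_apply, sl2_mul_apply, sl2_inv_apply_zero_one, sl2_inv_apply_one_one,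
    conj_apply]
  ring

theorem twistedConj_conj_apply_one_zero (h X : SpecialLinearGroup (Fin 2) (QuadOrder e)) :
    twistedConj conj h X 1 0 = (h 1 0 * X 0 0 + h 1 1 * X 1 0) * star (h 1 1) -
      (h 1 0 * X 0 1 + h 1 1 * X 1 1) * star (h 1 0) := by
  simp only [twistedConj_apply, sl2_mul_apply, sl2_inv_apply_zero_zero, sl2_inv_apply_one_zero,
    conj_apply]
  ring

theorem sqrtDisc_mul_self : sqrtDisc e * sqrtDisc e = ((1 + 4 * e : ℤ) : QuadOrder e) := by
  rw [QuadraticAlgebra.ext_iff, QuadraticAlgebra.re_intCast, QuadraticAlgebra.im_intCast]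
  constructor
  · simp [sqrtDisc]
    ring
  · simp [sqrtDisc]

theorem sub_star_eq (x : QuadOrder e) : x - star x = x.im * sqrtDisc e := by
  ext
  · simp [sqrtDisc]
  · simp [sqrtDisc]
    ring

theorem norm_nonneg (he : e ≤ -1) (x : QuadOrder e) : 0 ≤ x.norm := by
  rw [QuadraticAlgebra.norm_def]
  nlinarith [sq_nonneg (2 * x.re + x.im), mul_self_nonneg x.im]

theorem norm_pos (he : e ≤ -1) {x : QuadOrder e} (hx : x ≠ 0) : 0 < x.norm := by
  rw [QuadraticAlgebra.norm_def]
  by_contra! h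
  have h1 : x.im = 0 := by
    have : x.im * x.im ≤ 0 := by
      nlinarith [sq_nonneg (2 * x.re + x.im), mul_self_nonneg x.im]
    exact mul_self_eq_zero.1 (le_antisymm this (mul_self_nonneg _))
  have h2 : x.re = 0 := by
    rw [h1] at h
    have : x.re * x.re ≤ 0 := by linarith
    exact mul_self_eq_zero.1 (le_antisymm this (mul_self_nonneg _))
  exact hx (by ext <;> simp [h1, h2])

theorem norm_sub_le (he : e ≤ -1) (x y : QuadOrder e) :
    (x - y).norm ≤ 2 * (x.norm + y.norm) := by
  have := norm_nonneg he (x + y)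
  simp only [QuadraticAlgebra.norm_def, QuadraticAlgebra.re_add, QuadraticAlgebra.im_add,
    QuadraticAlgebra.re_sub, QuadraticAlgebra.im_sub] at *
  linarith

theorem finite_norm_le (he : e ≤ -1) (B : ℤ) : {x : QuadOrder e | x.norm ≤ B}.Finite := by
  have h : Set.InjOn (QuadraticAlgebra.equivProd e 1) {x : QuadOrder e | x.norm ≤ B} :=
    (Equiv.injective _).injOn
  refine Set.Finite.of_finite_image (Set.Finite.subset
    ((Set.finite_Icc (-(4 * |B|)) (4 * |B|)).prod (Set.finite_Icc (-(4 * |B|)) (4 * |B|))) ?_) h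
  rintro _ ⟨x, hx, rfl⟩
  simp only [Set.mem_ofPred_eq, QuadraticAlgebra.norm_def] at hx
  have hB := le_abs_self B
  have key : ∀ z : ℤ, z * z ≤ 4 * |B| → z ∈ Set.Icc (-(4 * |B|)) (4 * |B|) := by
    intro z hz
    rw [← abs_mul_abs_self] at hz
    rw [Set.mem_Icc, ← abs_le]
    rcases eq_or_ne z 0 with rfl | h0
    · simp
    · nlinarith [abs_pos.2 h0]
  refine ⟨key _ ?_, key _ ?_⟩
  · change x.re * x.re ≤ _
    nlinarith [sq_nonneg (x.re + 2 * x.im), mul_self_nonneg x.re, mul_self_nonneg x.im]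
  · change x.im * x.im ≤ _
    nlinarith [sq_nonneg (2 * x.re + x.im), mul_self_nonneg x.im]

theorem eq_intCast_mul_sqrtDisc {y : QuadOrder e} (hy : star y = -y) :
    y = ((-y.re : ℤ) : QuadOrder e) * sqrtDisc e := by
  have h := congrArg QuadraticAlgebra.re hy
  simp only [QuadraticAlgebra.re_star, QuadraticAlgebra.re_neg, one_mul] at h
  ext
  · simp [sqrtDisc]
  · simp [sqrtDisc]
    linarith

theorem eq_one_or_eq_neg_one_of_norm (he : e ≤ -2) {x : QuadOrder e} (hx : x.norm = 1) :
    x = 1 ∨ x = -1 := by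
  rw [QuadraticAlgebra.norm_def] at hx
  have h1 : x.im = 0 := by
    by_contra h
    have : 0 < x.im * x.im := mul_self_pos.2 h
    nlinarith [sq_nonneg (2 * x.re + x.im)]
  rw [h1] at hx
  have h2 : x.re * x.re = 1 := by linarith
  rcases mul_self_eq_one_iff.1 h2 with h | h
  · left; ext <;> simp [h, h1]
  · right; ext <;> simp [h, h1]

theorem neg_intCast_mul_sqrtDisc_mul (a b : ℤ) :
    ((-a : ℤ) : QuadOrder e) * sqrtDisc e * (((-b : ℤ) : QuadOrder e) * sqrtDisc e) =
      ((a * b * (1 + 4 * e) : ℤ) : QuadOrder e) := by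
  rw [Int.cast_mul, ← sqrtDisc_mul_self]
  push_cast
  ring

theorem norm_sqrtDisc : (sqrtDisc e).norm = -1 - 4 * e := by
  simp [QuadraticAlgebra.norm_def, sqrtDisc]
  ring

/-- The orbit of the identity under the twisted conjugation action; its elements parametrize the
translates of the oriented hyperbolic plane over the real line. -/
def planes (e : ℤ) : Set (SpecialLinearGroup (Fin 2) (QuadOrder e)) :=
  {X | ∃ g, X = g * (conj g)⁻¹}

variable {X : SpecialLinearGroup (Fin 2) (QuadOrder e)}

theorem apply_one_one_of_mem_planes (hX : X ∈ planes e) : X 1 1 = star (X 0 0) := by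
  obtain ⟨g, rfl⟩ := hX
  simp only [sl2_mul_apply, sl2_inv_apply_zero_zero, sl2_inv_apply_one_zero,
    sl2_inv_apply_zero_one, sl2_inv_apply_one_one, conj_apply, star_add, star_mul, star_neg,
    star_star]
  ring

theorem apply_one_zero_of_mem_planes (hX : X ∈ planes e) :
    X 1 0 = ((-(X 1 0).re : ℤ) : QuadOrder e) * sqrtDisc e := by
  apply eq_intCast_mul_sqrtDisc
  obtain ⟨g, rfl⟩ := hX
  simp only [sl2_mul_apply, sl2_inv_apply_zero_zero, sl2_inv_apply_one_zero,
    conj_apply, star_add, star_mul, star_neg, star_star]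
  ring

theorem apply_zero_one_of_mem_planes (hX : X ∈ planes e) :
    X 0 1 = ((-(X 0 1).re : ℤ) : QuadOrder e) * sqrtDisc e := by
  apply eq_intCast_mul_sqrtDisc
  obtain ⟨g, rfl⟩ := hX
  simp only [sl2_mul_apply, sl2_inv_apply_zero_one, sl2_inv_apply_one_one,
    conj_apply, star_add, star_mul, star_neg, star_star]
  ring

theorem sqrtDisc_dvd_of_mem_planes (hX : X ∈ planes e) : sqrtDisc e ∣ X 0 0 - 1 := by
  obtain ⟨g, rfl⟩ := hX
  refine ⟨g 0 1 * (g 1 0).im - g 0 0 * (g 1 1).im, ?_⟩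
  simp only [sl2_mul_apply, sl2_inv_apply_zero_zero, sl2_inv_apply_one_zero, conj_apply]
  linear_combination sl2_det_eq g - g 0 0 * sub_star_eq (g 1 1) + g 0 1 * sub_star_eq (g 1 0)

theorem apply_zero_zero_of_apply_one_zero (he : e ≤ -2) (hX : X ∈ planes e) (h : X 1 0 = 0) :
    X 0 0 = 1 := by
  have h1 : (X 0 0).norm = 1 := by
    have := sl2_det_eq X
    rw [h, mul_zero, sub_zero, apply_one_one_of_mem_planes hX,
      ← QuadraticAlgebra.algebraMap_norm_eq_mul_star] at this
    simpa using congrArg QuadraticAlgebra.re this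
  refine (eq_one_or_eq_neg_one_of_norm he h1).resolve_right fun h2 => ?_
  obtain ⟨s, hs⟩ := sqrtDisc_dvd_of_mem_planes hX
  have h3 := congrArg QuadraticAlgebra.norm hs
  have h4 : (X 0 0 - 1).norm = 4 := by
    rw [h2]
    simp [QuadraticAlgebra.norm_def]
  rw [h4, map_mul, norm_sqrtDisc] at h3
  have h5 : 0 < s.norm := by
    by_contra! h
    nlinarith
  nlinarith

/-- Signs of `X 1 0 / √D` before and after translation are compared by a norm inequality. -/
theorem norm_sub_norm_eq (hX : X ∈ planes e) (h : SpecialLinearGroup (Fin 2) (QuadOrder e)) :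
    (h 1 0 * X 0 0 + h 1 1 * X 1 0).norm - (h 1 0).norm =
      (X 1 0).re * (twistedConj conj h X 1 0).re * (-1 - 4 * e) := by
  have hX' := twistedConj_mem_range conj h hX
  have h1 := apply_one_zero_of_mem_planes hX
  have h2 := apply_one_zero_of_mem_planes hX'
  have hs : star (X 1 0) = -X 1 0 := by
    rw [h1]
    ext <;> simp [sqrtDisc]
    ring
  have key : (h 1 0 * X 0 0 + h 1 1 * X 1 0) * star (h 1 0 * X 0 0 + h 1 1 * X 1 0) -
      h 1 0 * star (h 1 0) = -(X 1 0 * twistedConj conj h X 1 0) := by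
    rw [twistedConj_conj_apply_one_zero, star_add, star_mul, star_mul, hs,
      ← apply_one_one_of_mem_planes hX]
    linear_combination (h 1 0 * star (h 1 0)) * sl2_det_eq X
  have h3 : X 1 0 * twistedConj conj h X 1 0 =
      (((X 1 0).re * (twistedConj conj h X 1 0).re * (1 + 4 * e) : ℤ) : QuadOrder e) := by
    rw [← neg_intCast_mul_sqrtDisc_mul, ← h1, ← h2]
  rw [h3, ← QuadraticAlgebra.algebraMap_norm_eq_mul_star,
    ← QuadraticAlgebra.algebraMap_norm_eq_mul_star] at key
  have := congrArg QuadraticAlgebra.re key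
  simp only [QuadraticAlgebra.re_sub, QuadraticAlgebra.algebraMap_re, QuadraticAlgebra.re_neg,
    QuadraticAlgebra.re_intCast, Int.cast_id] at this
  linarith

theorem re_intCast_mul_sqrtDisc (n : ℤ) : ((n : QuadOrder e) * sqrtDisc e).re = -n := by
  simp [sqrtDisc]

theorem conj_upperUnipotent (x : QuadOrder e) :
    conj (upperUnipotent x) = upperUnipotent (star x) := by
  apply sl2_ext <;> simp [upperUnipotent, conj_apply]

theorem twistedConj_upperUnipotent (x y : QuadOrder e) :
    twistedConj conj (upperUnipotent x) (upperUnipotent y) =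
      upperUnipotent (y + x.im * sqrtDisc e) := by
  rw [twistedConj_apply, conj_upperUnipotent, ← upperUnipotent_neg, ← upperUnipotent_add,
    ← upperUnipotent_add, ← sub_star_eq]
  ring_nf

theorem upperUnipotent_mem_planes (n : ℤ) : upperUnipotent (n * sqrtDisc e) ∈ planes e := by
  refine ⟨upperUnipotent (⟨0, n⟩ : QuadOrder e), ?_⟩
  rw [conj_upperUnipotent, ← upperUnipotent_neg, ← upperUnipotent_add, ← sub_eq_add_neg,
    sub_star_eq]

theorem exists_eq_upperUnipotent (he : e ≤ -2) (hX : X ∈ planes e) (h : (X 1 0).re = 0) :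
    ∃ n : ℤ, X = upperUnipotent (n * sqrtDisc e) := by
  have h10 : X 1 0 = 0 := by
    rw [apply_one_zero_of_mem_planes hX, h]
    simp
  have h00 := apply_zero_zero_of_apply_one_zero he hX h10
  refine ⟨_, sl2_ext h00 (apply_zero_one_of_mem_planes hX) h10 ?_⟩
  rw [apply_one_one_of_mem_planes hX, h00, star_one]
  rfl

/-- The planes lying on the positive side of a base point high up in hyperbolic space. -/
def positivePlanes (e : ℤ) : Set (SpecialLinearGroup (Fin 2) (QuadOrder e)) :=
  {X | X ∈ planes e ∧ (0 < (X 1 0).re ∨ (X 1 0).re = 0 ∧ (X 0 1).re < 0)}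

theorem upperUnipotent_mem_positivePlanes (n : ℤ) :
    upperUnipotent (n * sqrtDisc e) ∈ positivePlanes e ↔ 0 < n := by
  have h0 : (upperUnipotent ((n : QuadOrder e) * sqrtDisc e) 1 0).re = 0 := rfl
  have h1 : (upperUnipotent ((n : QuadOrder e) * sqrtDisc e) 0 1).re = -n :=
    re_intCast_mul_sqrtDisc n
  simp [positivePlanes, upperUnipotent_mem_planes, h0, h1]

theorem exists_bound_twistedConj_upperUnipotent (he : e ≤ -1)
    (h : SpecialLinearGroup (Fin 2) (QuadOrder e)) :
    ∃ K : ℤ, ∀ n : ℤ,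
      (K < n → twistedConj conj h (upperUnipotent (n * sqrtDisc e)) ∈ positivePlanes e) ∧
      (n < -K → twistedConj conj h (upperUnipotent (n * sqrtDisc e)) ∉ positivePlanes e) := by
  obtain ⟨k, hk⟩ : ∃ k : ℤ, ∀ n : ℤ,
      (twistedConj conj h (upperUnipotent (n * sqrtDisc e)) 1 0).re = k + (h 1 0).norm * n := by
    refine ⟨(h 1 0 * star (h 1 1) - h 1 1 * star (h 1 0)).re, fun n => ?_⟩
    have : twistedConj conj h (upperUnipotent (n * sqrtDisc e)) 1 0 =
        (h 1 0 * star (h 1 1) - h 1 1 * star (h 1 0)) -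
          algebraMap ℤ (QuadOrder e) (h 1 0).norm * ((n : QuadOrder e) * sqrtDisc e) := by
      rw [twistedConj_conj_apply_one_zero, QuadraticAlgebra.algebraMap_norm_eq_mul_star]
      simp only [upperUnipotent, sl2Mk_zero_zero, sl2Mk_zero_one, sl2Mk_one_zero, sl2Mk_one_one]
      ring
    rw [this]
    simp [sqrtDisc]
  obtain ⟨l, hl⟩ : ∃ l : ℤ, ∀ n : ℤ,
      (twistedConj conj h (upperUnipotent (n * sqrtDisc e)) 0 1).re = l - (h 0 0).norm * n := by
    refine ⟨(h 0 1 * star (h 0 0) - h 0 0 * star (h 0 1)).re, fun n => ?_⟩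
    have : twistedConj conj h (upperUnipotent (n * sqrtDisc e)) 0 1 =
        (h 0 1 * star (h 0 0) - h 0 0 * star (h 0 1)) +
          algebraMap ℤ (QuadOrder e) (h 0 0).norm * ((n : QuadOrder e) * sqrtDisc e) := by
      rw [twistedConj_conj_apply_zero_one, QuadraticAlgebra.algebraMap_norm_eq_mul_star]
      simp only [upperUnipotent, sl2Mk_zero_zero, sl2Mk_zero_one, sl2Mk_one_zero, sl2Mk_one_one]
      ring
    rw [this]
    simp [sqrtDisc]
    ring
  have hmem : ∀ n : ℤ, twistedConj conj h (upperUnipotent (n * sqrtDisc e)) ∈ planes e :=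
    fun n => twistedConj_mem_range conj h (upperUnipotent_mem_planes n)
  have hk0 : h 1 0 = 0 → k = 0 := by
    intro hc
    have := hk 0
    rw [twistedConj_conj_apply_one_zero, hc] at this
    simpa [upperUnipotent] using this.symm
  refine ⟨|k| + |l|, fun n => ?_⟩
  have := le_abs_self k
  have := neg_abs_le k
  have := le_abs_self l
  have := neg_abs_le l
  have := abs_nonneg k
  have := abs_nonneg l
  simp only [positivePlanes, Set.mem_ofPred_eq, hmem n, true_and, hk, hl]
  rcases eq_or_ne (h 1 0) 0 with hc | hc
  · have ha : 0 < (h 0 0).norm := by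
      refine norm_pos he fun ha => ?_
      have := sl2_det_eq h
      simp [hc, ha] at this
    rw [hk0 hc, abs_zero, zero_add] at *
    simp only [hc, QuadraticAlgebra.norm_zero, zero_mul, add_zero, lt_irrefl, false_or,
      true_and]
    constructor <;> intro hn <;> nlinarith
  · have hc' := norm_pos he hc
    constructor
    · intro hn
      left
      nlinarith
    · rintro hn (h1 | h1)
      · nlinarith
      · nlinarith

theorem finite_crossing_planes (he : e ≤ -1) (h : SpecialLinearGroup (Fin 2) (QuadOrder e)) :
    {X | X ∈ planes e ∧ 0 < (X 1 0).re ∧ (twistedConj conj h X 1 0).re < 0}.Finite := by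
  set B : ℤ := (h 1 0).norm with hB
  set B' : ℤ := 2 * (B + (h 1 1).norm * ((-1 - 4 * e) * (B * B))) with hB'
  refine Set.Finite.of_finite_image (f := fun X => (X 0 0, (X 1 0).re, (X 0 1).re))
    (Set.Finite.subset ((finite_norm_le he B').prod ((Set.finite_Icc 0 B).prod
      (Set.finite_Icc (-(1 + B')) (1 + B')))) ?_) ?_
  · rintro _ ⟨X, ⟨hX, h1, h2⟩, rfl⟩
    have hid := norm_sub_norm_eq hX h
    have hu := norm_nonneg he (h 1 0 * X 0 0 + h 1 1 * X 1 0)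
    have hd := norm_nonneg he (h 1 1)
    have hx := norm_nonneg he (X 0 0)
    have hpq : (X 1 0).re ≤ (X 1 0).re * -(twistedConj conj h X 1 0).re := by nlinarith
    have hm : (X 1 0).re ≤ B ∧ (h 1 0 * X 0 0 + h 1 1 * X 1 0).norm ≤ B ∧ 0 < B := by
      refine ⟨?_, ?_, ?_⟩ <;> nlinarith
    obtain ⟨hm, huB, hB0⟩ := hm
    have hz : (X 1 0).norm = (-1 - 4 * e) * ((X 1 0).re * (X 1 0).re) := by
      conv_lhs => rw [apply_one_zero_of_mem_planes hX, map_mul, norm_sqrtDisc]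
      simp
      ring
    have hxB : (X 0 0).norm ≤ B' := by
      have h3 := norm_sub_le he (h 1 0 * X 0 0 + h 1 1 * X 1 0) (h 1 1 * X 1 0)
      rw [add_sub_cancel_right, map_mul, map_mul, hz, ← hB] at h3
      have h4 : (X 1 0).re * (X 1 0).re ≤ B * B := by nlinarith
      have h5 : (h 1 1).norm * ((-1 - 4 * e) * ((X 1 0).re * (X 1 0).re)) ≤
        (h 1 1).norm * ((-1 - 4 * e) * (B * B)) := by
        apply mul_le_mul_of_nonneg_left _ hd
        apply mul_le_mul_of_nonneg_left h4 (by linarith)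
      nlinarith
    have hn : (X 0 0).norm + (-1 - 4 * e) * ((X 1 0).re * (X 0 1).re) = 1 := by
      have h3 := sl2_det_eq X
      have h4 : X 0 1 * X 1 0 =
          (((X 0 1).re * (X 1 0).re * (1 + 4 * e) : ℤ) : QuadOrder e) := by
        rw [← neg_intCast_mul_sqrtDisc_mul, ← apply_zero_one_of_mem_planes hX,
          ← apply_one_zero_of_mem_planes hX]
      rw [h4, apply_one_one_of_mem_planes hX,
        ← QuadraticAlgebra.algebraMap_norm_eq_mul_star] at h3
      have h5 := congrArg QuadraticAlgebra.re h3
      simp only [QuadraticAlgebra.re_sub, QuadraticAlgebra.algebraMap_re,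
        QuadraticAlgebra.re_intCast, Int.cast_id, QuadraticAlgebra.re_one] at h5
      linarith
    refine ⟨hxB, ⟨h1.le, hm⟩, abs_le.1 ?_⟩
    have h6 : |(-1 - 4 * e) * ((X 1 0).re * (X 0 1).re)| ≤ 1 + B' := by
      rw [abs_le]
      constructor <;> linarith
    rw [abs_mul, abs_mul, abs_of_pos h1, abs_of_pos (by linarith : 0 < -1 - 4 * e)] at h6
    have h7 := abs_nonneg (X 0 1).re
    have h8 : 1 ≤ (-1 - 4 * e) * (X 1 0).re := by nlinarith
    change |(X 0 1).re| ≤ _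
    nlinarith
  · rintro X ⟨hX, -⟩ Y ⟨hY, -⟩ hXY
    simp only [Prod.mk.injEq] at hXY
    obtain ⟨h1, h2, h3⟩ := hXY
    refine sl2_ext h1 ?_ ?_ ?_
    · rw [apply_zero_one_of_mem_planes hX, apply_zero_one_of_mem_planes hY, h3]
    · rw [apply_one_zero_of_mem_planes hX, apply_one_zero_of_mem_planes hY, h2]
    · rw [apply_one_one_of_mem_planes hX, apply_one_one_of_mem_planes hY, h1]

theorem finite_separating_planes (he : e ≤ -2) (h : SpecialLinearGroup (Fin 2) (QuadOrder e)) :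
    {X | X ∈ positivePlanes e ∧ twistedConj conj h X ∉ positivePlanes e}.Finite := by
  obtain ⟨K, hK⟩ := exists_bound_twistedConj_upperUnipotent (by linarith) h
  obtain ⟨L, hL⟩ := exists_bound_twistedConj_upperUnipotent (by linarith) h⁻¹
  let t : ℤ → SpecialLinearGroup (Fin 2) (QuadOrder e) := fun n => upperUnipotent (n * sqrtDisc e)
  refine ((finite_crossing_planes (by linarith) h).union (((Set.finite_Icc 0 K).image t).union
    ((Set.finite_Icc (-L) 0).image (twistedConj conj h⁻¹ ∘ t)))).subset ?_
  rintro X ⟨hX, hX'⟩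
  have hY : twistedConj conj h X ∈ planes e := twistedConj_mem_range conj h hX.1
  have hinv : twistedConj conj h⁻¹ (twistedConj conj h X) = X := by
    rw [← Equiv.Perm.mul_apply, ← map_mul, inv_mul_cancel, map_one, Equiv.Perm.one_apply]
  by_cases h1 : (X 1 0).re = 0
  · obtain ⟨n, rfl⟩ := exists_eq_upperUnipotent he hX.1 h1
    refine Or.inr (Or.inl ⟨n, ⟨?_, ?_⟩, rfl⟩)
    · exact ((upperUnipotent_mem_positivePlanes n).1 hX).le
    · by_contra! h2
      exact hX' ((hK n).1 h2)
  by_cases h2 : (twistedConj conj h X 1 0).re = 0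
  · obtain ⟨n, hn⟩ := exists_eq_upperUnipotent he hY h2
    refine Or.inr (Or.inr ⟨n, ⟨?_, ?_⟩, ?_⟩)
    · by_contra! h3
      exact (hL n).2 h3 (by rw [← hn, hinv]; exact hX)
    · by_contra! h3
      exact hX' (by rw [hn]; exact (upperUnipotent_mem_positivePlanes n).2 h3)
    · simp only [Function.comp_apply, t]
      rw [← hn, hinv]
  · refine Or.inl ⟨hX.1, hX.2.resolve_right fun h3 => h1 h3.1, ?_⟩
    have h3 : ¬ 0 < (twistedConj conj h X 1 0).re := fun h3 => hX' ⟨hY, Or.inl h3⟩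
    omega

/-- Counting modulo two the planes separating a base point from its translate yields a nontrivial
character of `SL(2, ℤ[ω])`. -/
theorem exists_character (he : e ≤ -2) :
    ∃ χ : SpecialLinearGroup (Fin 2) (QuadOrder e) →* Multiplicative (ZMod 2),
      χ (-1) = 1 ∧ χ (upperUnipotent ⟨0, 1⟩) ≠ 1 := by
  obtain ⟨χ, hχ⟩ := exists_parity_character (twistedConj conj) (positivePlanes e)
    (finite_separating_planes he)
  refine ⟨χ, ?_, ?_⟩
  · have h1 : twistedConj (conj (e := e)) (-1) = 1 := by
      have h2 : conj (-1 : SpecialLinearGroup (Fin 2) (QuadOrder e)) = -1 := by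
        apply sl2_ext <;> simp [conj_apply]
      ext1 X
      rw [twistedConj_apply, h2]
      simp [inv_neg]
    rw [hχ, h1]
    simp
  · have h1 : symmDiff (twistedConj conj (upperUnipotent ⟨0, 1⟩) ⁻¹' positivePlanes e)
        (positivePlanes e) = {upperUnipotent 0} := by
      ext X
      by_cases hX : X ∈ planes e
      · by_cases h2 : (X 1 0).re = 0
        · obtain ⟨n, rfl⟩ := exists_eq_upperUnipotent he hX h2
          have h3 : (n : QuadOrder e) * sqrtDisc e + ((1 : ℤ) : QuadOrder e) * sqrtDisc e =
              ((n + 1 : ℤ) : QuadOrder e) * sqrtDisc e := by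
            push_cast
            ring
          rw [Set.mem_symmDiff, Set.mem_preimage, twistedConj_upperUnipotent, h3,
            upperUnipotent_mem_positivePlanes, upperUnipotent_mem_positivePlanes,
            Set.mem_singleton_iff]
          constructor
          · intro h4
            have h5 : n = 0 := by omega
            rw [h5, Int.cast_zero, zero_mul]
          · intro h4
            have h5 := congrArg (fun Y => (Y 0 1).re) h4
            have h6 : -n = 0 := by
              rw [← re_intCast_mul_sqrtDisc (e := e)]
              exact h5
            omega
        · have h3 : twistedConj conj (upperUnipotent ⟨0, 1⟩) X 1 0 = X 1 0 := by
            rw [twistedConj_conj_apply_one_zero]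
            simp [upperUnipotent]
          have h4 := twistedConj_mem_range conj (upperUnipotent ⟨0, 1⟩) hX
          constructor
          · rintro (⟨⟨-, h5⟩, h6⟩ | ⟨⟨-, h5⟩, h6⟩)
            · rw [h3] at h5
              exact absurd ⟨hX, Or.inl (h5.resolve_right fun h7 => h2 h7.1)⟩ h6
            · refine absurd ⟨h4, Or.inl ?_⟩ h6
              rw [h3]
              exact h5.resolve_right fun h7 => h2 h7.1
          · rintro rfl
            exact absurd rfl h2
      · constructor
        · rintro (⟨h2, -⟩ | ⟨h2, -⟩)
          · have h3 := twistedConj_mem_range conj (upperUnipotent ⟨0, 1⟩)⁻¹ h2.1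
            rw [← Equiv.Perm.mul_apply, ← map_mul, inv_mul_cancel, map_one,
              Equiv.Perm.one_apply] at h3
            exact absurd h3 hX
          · exact absurd h2.1 hX
        · rintro rfl
          refine absurd ⟨1, ?_⟩ hX
          rw [upperUnipotent_zero, map_one, mul_inv_cancel]
    rw [hχ, h1, Set.ncard_singleton]
    decide

/-- A character of exponent two trivial on matrices congruent to the identity modulo `N` is trivial
on `[[1, ω], [0, 1]]`, because the residue field at `2` has four elements. -/
theorem character_eq_one_of_congruence (he : Odd e)
    (χ : SpecialLinearGroup (Fin 2) (QuadOrder e) →* Multiplicative (ZMod 2)) {N : ℕ} (hN : N ≠ 0)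
    (hχ : ∀ M : SpecialLinearGroup (Fin 2) (QuadOrder e), (N : QuadOrder e) ∣ M 0 0 - 1 →
      (N : QuadOrder e) ∣ M 0 1 → (N : QuadOrder e) ∣ M 1 0 → (N : QuadOrder e) ∣ M 1 1 - 1 →
      χ M = 1) :
    χ (upperUnipotent ⟨0, 1⟩) = 1 := by
  have hsq : ∀ z : Multiplicative (ZMod 2), z * z = 1 := by decide
  obtain ⟨k, q, hq, rfl⟩ := Nat.exists_eq_two_pow_mul_odd hN
  set w : QuadOrder e := ⟨0, 1⟩ with hw
  obtain ⟨s, r, hsr⟩ : IsCoprime (-e) ((2 : ℤ) ^ k) :=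
    IsCoprime.pow_right (Int.isCoprime_iff_gcd_eq_one.2 (by
      obtain ⟨m, rfl⟩ := he
      rw [Int.gcd_comm, ← Int.isCoprime_iff_gcd_eq_one]
      exact ⟨-m, -1, by ring⟩))
  set t : QuadOrder e := (r : QuadOrder e) * 2 ^ k with ht
  set v : QuadOrder e := (s : QuadOrder e) * star w with hv
  have huv : w * v = 1 - t := by
    have h1 : w * star w = ((-e : ℤ) : QuadOrder e) := by
      ext <;> simp [hw]
    have h2 := congrArg (Int.cast (R := QuadOrder e)) hsr
    push_cast at h2 h1
    rw [hv, ht]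
    linear_combination s * h1 + h2
  let h : SpecialLinearGroup (Fin 2) (QuadOrder e) :=
    sl2Mk w t (-t) (v * (1 + t)) (by linear_combination (1 + t) * huv)
  have hN : ∀ x : QuadOrder e, ((2 ^ k * q : ℕ) : QuadOrder e) ∣ (q : QuadOrder e) * t * x := by
    intro x
    refine ⟨r * x, ?_⟩
    rw [ht]
    push_cast
    ring
  have h1 : χ (h * upperUnipotent (q : QuadOrder e) * h⁻¹ *
      upperUnipotent (-((q : QuadOrder e) * w ^ 2))) = 1 := by
    apply hχ <;> simp only [sl2_mul_apply, sl2_inv_apply_zero_zero, sl2_inv_apply_one_zero,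
      sl2_inv_apply_zero_one, sl2_inv_apply_one_one, h, upperUnipotent, sl2Mk_zero_zero,
      sl2Mk_zero_one, sl2Mk_one_zero, sl2Mk_one_one]
    · convert hN w using 1
      linear_combination (1 + t) * huv
    · convert hN (-(q * w ^ 3)) using 1
      linear_combination (-(1 + t) * q * w ^ 2) * huv
    · convert hN (-t) using 1
      ring
    · convert hN (q * t * w ^ 2 - w) using 1
      linear_combination (1 + t) * huv
  have h2 : χ (upperUnipotent ((q : QuadOrder e) - q * w ^ 2)) = 1 := by
    rw [map_mul, map_mul, map_mul, map_inv, mul_right_comm (χ h), mul_inv_cancel, one_mul,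
      ← map_mul, ← upperUnipotent_add] at h1
    rwa [sub_eq_add_neg]
  obtain ⟨m, rfl⟩ := he
  obtain ⟨l, rfl⟩ := hq
  have h3 : w = ((2 * l + 1 : ℕ) : QuadOrder (2 * m + 1)) - (2 * l + 1 : ℕ) * w ^ 2 +
      (((2 * l + 1) * m : ℤ) + (l + 1) * w) + (((2 * l + 1) * m : ℤ) + (l + 1) * w) := by
    have h4 : w ^ 2 = w + ((2 * m + 1 : ℤ) : QuadOrder (2 * m + 1)) := by
      ext <;> simp [hw, sq]
    rw [h4]
    push_cast
    ring
  rw [h3, upperUnipotent_add, upperUnipotent_add, map_mul, map_mul, h2, one_mul, hsq]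

theorem exists_two_mul_abs_sub_le (x : ℤ) {n : ℤ} (hn : 0 < n) : ∃ q : ℤ, 2 * |x - q * n| ≤ n := by
  refine ⟨(2 * x + n) / (2 * n), ?_⟩
  have h1 := Int.emod_add_mul_ediv (2 * x + n) (2 * n)
  have h2 := Int.emod_nonneg (2 * x + n) (by lia : 2 * n ≠ 0)
  have h3 := Int.emod_lt_of_pos (2 * x + n) (by lia : 0 < 2 * n)
  have h4 : 2 * n * ((2 * x + n) / (2 * n)) = 2 * ((2 * x + n) / (2 * n) * n) := by ring
  rcases abs_cases (x - (2 * x + n) / (2 * n) * n) with ⟨h, -⟩ | ⟨h, -⟩ <;> rw [h] <;> linarith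

theorem exists_norm_sub_mul_lt (a : QuadOrder (-1)) {c : QuadOrder (-1)} (hc : c ≠ 0) :
    ∃ q, (a - q * c).norm < c.norm := by
  have hn := norm_pos (e := -1) le_rfl hc
  obtain ⟨r, hr⟩ := exists_two_mul_abs_sub_le (a * star c).re hn
  obtain ⟨s, hs⟩ := exists_two_mul_abs_sub_le (a * star c).im hn
  refine ⟨⟨r, s⟩, ?_⟩
  have key : (a - ⟨r, s⟩ * c) * star c =
      ⟨(a * star c).re - r * c.norm, (a * star c).im - s * c.norm⟩ := by
    ext <;> simp [QuadraticAlgebra.norm_def] <;> ring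
  have hN := congrArg QuadraticAlgebra.norm key
  have hform (u v : ℤ) :
      QuadraticAlgebra.norm (⟨u, v⟩ : QuadOrder (-1)) = u * u + u * v + v * v := by
    rw [QuadraticAlgebra.norm_def]
    ring
  rw [map_mul, QuadraticAlgebra.norm_star, hform ((a * star c).re - r * c.norm)] at hN
  generalize (a - ⟨r, s⟩ * c).norm = m at *
  generalize (a * star c).re - r * c.norm = u at *
  generalize (a * star c).im - s * c.norm = v at *
  generalize c.norm = n at *
  have : u * v ≤ |u| * |v| := by rw [← abs_mul]; exact le_abs_self _
  have hv := abs_mul_abs_self v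
  have hu := abs_mul_abs_self u
  have h1 := abs_nonneg u
  have h2 := abs_nonneg v
  have h3 : 4 * (m * n) ≤ 3 * (n * n) := by nlinarith
  nlinarith

/-- `SL(2, ℤ[ω])` is generated by elementary matrices, by the Euclidean algorithm. -/
theorem eq_top_of_unipotent_mem (H : Subgroup (SpecialLinearGroup (Fin 2) (QuadOrder (-1))))
    (hU : ∀ x, upperUnipotent x ∈ H) (hL : ∀ x, lowerUnipotent x ∈ H) : H = ⊤ := by
  have hS : weylElement _ ∈ H := by
    rw [weylElement_eq]
    exact H.mul_mem (H.mul_mem (hU _) (hL _)) (hU _)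
  rw [eq_top_iff]
  intro g _
  induction hn : (g 1 0).norm.toNat using Nat.strong_induction_on generalizing g with
  | _ n ih =>
  by_cases hc : g 1 0 = 0
  · have hdet := sl2_det_eq g
    rw [hc, mul_zero, sub_zero] at hdet
    have hg : g = upperUnipotent (g 0 0) * lowerUnipotent (-g 1 1) * upperUnipotent (g 0 0) *
        weylElement _ * upperUnipotent (g 1 1 * g 0 1) := by
      apply sl2_ext <;> simp [weylElement, upperUnipotent, lowerUnipotent, sl2_mul_apply, hc]
      · linear_combination -g 0 0 * hdet
      · linear_combination (g 0 0 * g 1 1 * g 0 1 - 1 - g 0 1) * hdet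
      · linear_combination hdet
      · linear_combination -(g 1 1 * g 0 1) * hdet
    rw [hg]
    exact H.mul_mem (H.mul_mem (H.mul_mem (H.mul_mem (hU _) (hL _)) (hU _)) hS) (hU _)
  · obtain ⟨q, hq⟩ := exists_norm_sub_mul_lt (g 0 0) hc
    let g' : SpecialLinearGroup (Fin 2) (QuadOrder (-1)) :=
      weylElement _ * upperUnipotent (-q) * g
    have hent : g' 1 0 = g 0 0 - q * g 1 0 := by
      simp [g', weylElement, upperUnipotent, sl2_mul_apply, sub_eq_add_neg]
    have h := ih _ ?_ (g := g') trivial rfl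
    · exact (H.mul_mem_cancel_left (H.mul_mem hS (hU _))).1 h
    · rw [hent]
      have := norm_nonneg (e := -1) le_rfl (g 0 0 - q * g 1 0)
      lia

/-- `SL(2, ℤ[ω])`, with `ω` a sixth root of unity, is generated by its squares. -/
theorem eq_top_of_sq_mem (H : Subgroup (SpecialLinearGroup (Fin 2) (QuadOrder (-1))))
    (hH : ∀ g, g ^ 2 ∈ H) : H = ⊤ := by
  have hcomm (a b : SpecialLinearGroup (Fin 2) (QuadOrder (-1))) : ⁅a, b⁆ ∈ H := by
    rw [commutatorElement_eq_mul_sq]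
    exact H.mul_mem (H.mul_mem (hH _) (hH _)) (hH _)
  have hU (x) : upperUnipotent x ∈ H := by
    have hD : (⟨0, 1⟩ * ⟨1, -1⟩ - 0 * 0 : QuadOrder (-1)) = 1 := by
      ext <;> simp
    have h1 := hcomm (sl2Mk ⟨0, 1⟩ 0 0 ⟨1, -1⟩ hD) (upperUnipotent (⟨-1, -1⟩ * x))
    have h2 : ⁅sl2Mk (⟨0, 1⟩ : QuadOrder (-1)) 0 0 ⟨1, -1⟩ hD,
        upperUnipotent ((⟨-1, -1⟩ : QuadOrder (-1)) * x)⁆ =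
        upperUnipotent (3 * x) := by
      rw [commutatorElement_def, mul_inv_eq_iff_eq_mul, mul_inv_eq_iff_eq_mul]
      apply sl2_ext <;> simp [upperUnipotent, sl2_mul_apply]
      obtain ⟨p, q⟩ := x
      have h3 : (3 : QuadOrder (-1)) = ⟨3, 0⟩ := rfl
      rw [h3]
      ext <;> simp <;> ring
    have h3 : upperUnipotent x = upperUnipotent (3 * x) * upperUnipotent (-x) ^ 2 := by
      rw [pow_two, ← upperUnipotent_add, ← upperUnipotent_add]
      congr 1
      ring
    rw [h3]
    exact H.mul_mem (h2 ▸ h1) (hH _)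
  refine eq_top_of_unipotent_mem H hU fun x => ?_
  rw [← weylElement_mul_upperUnipotent]
  have h := H.mul_mem (hcomm (weylElement _) (upperUnipotent (-x))) (hU (-x))
  rwa [commutatorElement_def, inv_mul_cancel_right] at h

end QuadOrder

theorem exists_intCast_eq_of_isIntegral_algebraMap {A : Type*} [CommRing A] [Nontrivial A]
    [Algebra ℚ A] {r : ℚ} (h : IsIntegral ℤ (algebraMap ℚ A r)) : ∃ n : ℤ, (n : ℚ) = r :=
  IsIntegrallyClosed.isIntegral_iff.1
    ((isIntegral_algebraMap_iff (algebraMap ℚ A).injective).1 h)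

theorem Squarefree.exists_intCast_eq_of_mul_sq {d : ℤ} (hd : Squarefree d) {s : ℚ} {m : ℤ}
    (h : d * s ^ 2 = m) : ∃ n : ℤ, (n : ℚ) = s := by
  have hd0 : (d : ℚ) ≠ 0 := by exact_mod_cast hd.ne_zero
  have hint : IsIntegral ℤ (algebraMap ℚ ℚ (d * s)) := by
    refine IsIntegral.of_pow (n := 2) two_pos ?_
    have : algebraMap ℚ ℚ (d * s) ^ 2 = algebraMap ℤ ℚ (d * m) := by
      simp only [Algebra.algebraMap_self, RingHom.id_apply, eq_intCast, Int.cast_mul]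
      rw [← h]
      ring
    rw [this]
    exact isIntegral_algebraMap
  obtain ⟨k, hk⟩ := exists_intCast_eq_of_isIntegral_algebraMap hint
  have hkd : d ∣ k ^ 2 := by
    refine ⟨m, ?_⟩
    have : (k : ℚ) ^ 2 = d * m := by
      rw [hk, ← h]
      ring
    exact_mod_cast this
  obtain ⟨n, rfl⟩ := (hd.dvd_pow_iff_dvd two_ne_zero).1 hkd
  refine ⟨n, ?_⟩
  push_cast at hk
  exact mul_left_cancel₀ hd0 hk

theorem exists_half_integers_of_isIntegral {d : ℤ} (hdsf : Squarefree d) (hd : d % 2 = 1)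
    {z : QuadraticAlgebra ℚ (d : ℚ) 0} (hz : IsIntegral ℤ z) :
    ∃ m s : ℤ, z.re = m + s / 2 ∧ z.im = s / 2 := by
  have hstar : IsIntegral ℤ (star z) :=
    hz.map (starRingEnd (QuadraticAlgebra ℚ (d : ℚ) 0)).toIntAlgHom
  obtain ⟨t, ht⟩ := exists_intCast_eq_of_isIntegral_algebraMap
    (A := QuadraticAlgebra ℚ (d : ℚ) 0) (r := 2 * z.re) (by
      have : algebraMap ℚ (QuadraticAlgebra ℚ (d : ℚ) 0) (2 * z.re) = z + star z := by
        ext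
        · simp [two_mul]
        · simp
      rw [this]
      exact hz.add hstar)
  obtain ⟨n, hn⟩ := exists_intCast_eq_of_isIntegral_algebraMap
    (A := QuadraticAlgebra ℚ (d : ℚ) 0) (r := z.norm) (by
      rw [QuadraticAlgebra.algebraMap_norm_eq_mul_star]
      exact hz.mul hstar)
  rw [QuadraticAlgebra.norm_def] at hn
  obtain ⟨s, hs⟩ := hdsf.exists_intCast_eq_of_mul_sq (s := 2 * z.im) (m := t ^ 2 - 4 * n) (by
    push_cast
    rw [ht, hn]
    ring)
  have hts : t ^ 2 - d * s ^ 2 = 4 * n := by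
    have : (t : ℚ) ^ 2 - d * s ^ 2 = 4 * n := by
      rw [ht, hn, hs]
      ring
    exact_mod_cast this
  have hpar : (t - s) % 2 = 0 := by
    have h := congrArg (· % 2) hts
    rcases Int.emod_two_eq_zero_or_one t with h1 | h1 <;>
    rcases Int.emod_two_eq_zero_or_one s with h2 | h2 <;>
    simp [pow_two, Int.sub_emod, Int.mul_emod, h1, h2, hd] at h ⊢
  obtain ⟨m, hm⟩ := Int.dvd_of_emod_eq_zero hpar
  refine ⟨m, s, ?_, by linarith⟩
  have : (t : ℚ) - s = 2 * m := by exact_mod_cast hm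
  linarith

theorem algHom_quadraticAlgebra_injective {d : ℚ} (hd : d < 0) {A : Type*} [CommRing A]
    [Nontrivial A] [Algebra ℚ A] (ψ : QuadraticAlgebra ℚ d 0 →ₐ[ℚ] A) : Function.Injective ψ := by
  rw [injective_iff_map_eq_zero]
  intro z hz
  have h : ψ (algebraMap ℚ _ z.norm) = 0 := by
    rw [QuadraticAlgebra.algebraMap_norm_eq_mul_star, map_mul, hz, zero_mul]
  rw [AlgHom.commutes, map_eq_zero, QuadraticAlgebra.norm_def] at h
  have h1 : z.im = 0 := by
    by_contra h1
    nlinarith [mul_self_pos.2 h1, mul_self_nonneg z.re]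
  rw [h1] at h
  ext
  · simpa using h
  · exact h1

variable {K} in
/-- The ring of integers of `ℚ(√d)`, `d = 1 + 4e` squarefree, is `ℤ[ω]` with `ω² = ω + e`. -/
theorem nonempty_quadOrder_ringEquiv {e : ℤ} (he : e ≤ -1) (hsf : Squarefree (1 + 4 * e))
    (hK2 : Module.finrank ℚ K = 2) {α : K} (hα : α ^ 2 = ((1 + 4 * e : ℤ) : K)) :
    Nonempty (QuadOrder e ≃+* 𝓞 K) := by
  have hw : IsIntegral ℤ ((1 + α) / 2) := by
    refine ⟨Polynomial.X ^ 2 - Polynomial.X - Polynomial.C e, by monicity!, ?_⟩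
    simp only [Polynomial.eval₂_sub, Polynomial.eval₂_X_pow, Polynomial.eval₂_X,
      Polynomial.eval₂_C]
    rw [eq_intCast]
    push_cast at hα
    linear_combination hα / 4
  obtain ⟨w, hwα⟩ : ∃ w : 𝓞 K, algebraMap (𝓞 K) K w = (1 + α) / 2 := ⟨⟨_, hw⟩, rfl⟩
  have hww : w * w = e • 1 + (1 : ℤ) • w := by
    apply RingOfIntegers.ext
    change algebraMap (𝓞 K) K _ = algebraMap (𝓞 K) K _
    rw [one_smul, zsmul_eq_mul, mul_one, map_mul, map_add, map_intCast, hwα]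
    push_cast at hα
    linear_combination hα / 4
  let f : QuadOrder e →ₐ[ℤ] 𝓞 K := QuadraticAlgebra.lift ⟨w, hww⟩
  have hf (x : QuadOrder e) : f x = x.re + x.im * w := by
    simp [f, QuadraticAlgebra.lift]
  refine ⟨RingEquiv.ofBijective f ⟨?_, ?_⟩⟩
  · rw [injective_iff_map_eq_zero]
    intro x hx
    by_contra h0
    have h : f (algebraMap ℤ _ x.norm) = 0 := by
      rw [QuadraticAlgebra.algebraMap_norm_eq_mul_star, map_mul, hx, zero_mul]
    rw [AlgHom.commutes, eq_intCast, Int.cast_eq_zero] at h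
    exact (QuadOrder.norm_pos he h0).ne' h
  · intro y
    let ψ : QuadraticAlgebra ℚ ((1 + 4 * e : ℤ) : ℚ) 0 →ₐ[ℚ] K :=
      QuadraticAlgebra.lift ⟨α, by rw [← pow_two, hα]; simp [Algebra.smul_def]⟩
    have hψ (z) : ψ z = z.re + z.im * α := by
      simp [ψ, QuadraticAlgebra.lift, Algebra.smul_def]
    have hinj : Function.Injective ψ :=
      algHom_quadraticAlgebra_injective (by exact_mod_cast (by lia : 1 + 4 * e < 0)) ψ
    obtain ⟨z, hz⟩ := (LinearMap.injective_iff_surjective_of_finrank_eq_finrank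
      (f := ψ.toLinearMap) (by rw [hK2, QuadraticAlgebra.finrank_eq_two])).1 hinj y
    have hzint : IsIntegral ℤ z := by
      rw [← isIntegral_algHom_iff (ψ.restrictScalars ℤ) hinj]
      change IsIntegral ℤ (ψ z)
      rw [AlgHom.toLinearMap_apply] at hz
      rw [hz]
      exact y.2
    obtain ⟨m, s, hre, him⟩ := exists_half_integers_of_isIntegral hsf (by lia) hzint
    refine ⟨⟨m, s⟩, ?_⟩
    apply RingOfIntegers.ext
    change algebraMap (𝓞 K) K (f _) = _
    rw [hf, ← hz, AlgHom.toLinearMap_apply, hψ, hre, him]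
    rw [map_add, map_mul, map_intCast, map_intCast, hwα]
    push_cast
    ring

theorem commutator_le_sqSubgroup (G : Type*) [Group G] : commutator G ≤ sqSubgroup G := by
  rw [commutator_def, Subgroup.commutator_le]
  intro a _ b _
  have h (x : G) : x ^ 2 ∈ sqSubgroup G := Subgroup.subset_closure ⟨x, rfl⟩
  rw [commutatorElement_eq_mul_sq]
  exact mul_mem (mul_mem (h _) (h _)) (h _)

section Congruence

variable {K}

theorem not_isCongruence_sqSubgroup {e : ℤ} (φ : QuadOrder e ≃+* 𝓞 K) (he : e ≤ -2) (hodd : Odd e) :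
    ¬ IsCongruence K (sqSubgroup (PSL K)) := by
  rintro ⟨π, hπ, hle⟩
  obtain ⟨χ, hneg, hne⟩ := QuadOrder.exists_character he
  let Φ := SpecialLinearGroup.map (n := Fin 2) (φ.symm : 𝓞 K →+* QuadOrder e)
  have hker : PM K ≤ (χ.comp Φ).ker := by
    rw [PM, Subgroup.closure_le]
    rintro x rfl
    have : Φ (-1) = -1 := by
      apply sl2_ext <;> simp [Φ]
    rw [SetLike.mem_coe, MonoidHom.mem_ker, MonoidHom.comp_apply, this, hneg]
  let χ' : PSL K →* Multiplicative (ZMod 2) := QuotientGroup.lift (PM K) (χ.comp Φ) hker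
  have hχ' (g) : χ' (proj K g) = χ (Φ g) := rfl
  have hsq : sqSubgroup (PSL K) ≤ χ'.ker := by
    rw [sqSubgroup, Subgroup.closure_le]
    rintro _ ⟨y, rfl⟩
    rw [SetLike.mem_coe, MonoidHom.mem_ker, map_pow]
    generalize χ' y = z
    revert z
    decide
  refine hne (QuadOrder.character_eq_one_of_congruence hodd χ
    (N := Ideal.absNorm π) (by rwa [Ne, Ideal.absNorm_eq_zero_iff]) ?_)
  intro M h00 h01 h10 h11
  let g := SpecialLinearGroup.map (n := Fin 2) (φ : QuadOrder e →+* 𝓞 K) M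
  have hΦ : Φ g = M := by
    apply sl2_ext <;> simp [Φ, g]
  have hmem (x : QuadOrder e) (hx : (Ideal.absNorm π : QuadOrder e) ∣ x) : φ x ∈ π := by
    obtain ⟨y, rfl⟩ := hx
    rw [map_mul, map_natCast]
    exact π.mul_mem_right _ (Ideal.absNorm_mem π)
  have hred : red K π g = 1 := by
    apply sl2_ext
    · simpa [red, g, sub_eq_zero] using Ideal.Quotient.eq_zero_iff_mem.2 (hmem _ h00)
    · simpa [red, g] using Ideal.Quotient.eq_zero_iff_mem.2 (hmem _ h01)
    · simpa [red, g] using Ideal.Quotient.eq_zero_iff_mem.2 (hmem _ h10)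
    · simpa [red, g, sub_eq_zero] using Ideal.Quotient.eq_zero_iff_mem.2 (hmem _ h11)
  have hG : proj K g ∈ Gbar K π := by
    refine ⟨g, ?_, rfl⟩
    rw [SetLike.mem_coe, Subgroup.mem_comap, hred]
    exact one_mem _
  have := MonoidHom.mem_ker.1 (hsq (hle hG))
  rwa [hχ', hΦ] at this

theorem sqSubgroup_eq_top (φ : QuadOrder (-1) ≃+* 𝓞 K) : sqSubgroup (PSL K) = ⊤ := by
  let Φ := (proj K).comp (SpecialLinearGroup.map (n := Fin 2) (φ : QuadOrder (-1) →+* 𝓞 K))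
  have htop := QuadOrder.eq_top_of_sq_mem ((sqSubgroup (PSL K)).comap Φ) fun g =>
    Subgroup.subset_closure ⟨Φ g, map_pow Φ g 2⟩
  rw [eq_top_iff]
  intro x _
  obtain ⟨g, rfl⟩ := QuotientGroup.mk'_surjective (PM K) x
  have hg : SpecialLinearGroup.map (n := Fin 2) (φ : QuadOrder (-1) →+* 𝓞 K)
      (SpecialLinearGroup.map (n := Fin 2) (φ.symm : 𝓞 K →+* QuadOrder (-1)) g) = g := by
    apply sl2_ext <;> simp
  have h : SpecialLinearGroup.map (n := Fin 2) (φ.symm : 𝓞 K →+* QuadOrder (-1)) g ∈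
      (sqSubgroup (PSL K)).comap Φ := htop ▸ Subgroup.mem_top _
  rw [Subgroup.mem_comap, MonoidHom.comp_apply, hg] at h
  exact h

end Congruence

/-- **Proposition 6.2.** Let `d < 0` be squarefree with `d ≡ 5 (mod 8)`, and let
`B_d = PSL(2, O_d)` where `O_d` is the ring of integers of `K = ℚ(√d)`.  Then the
commutator subgroup `[B_d, B_d]` and the power subgroup `B_d² = ⟨x² : x ∈ B_d⟩` are
non-congruence subgroups of `B_d` if and only if `d ≠ −3`. -/
theorem bianchi_commutator_squares_noncongruence
    (d : ℤ) (hd : d < 0) (hdsf : Squarefree d) (hd8 : d % 8 = 5)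
    (hK2 : Module.finrank ℚ K = 2) (α : K) (hα : α ^ 2 = (d : K)) :
    (¬ IsCongruence K (commutator (PSL K)) ∧ ¬ IsCongruence K (sqSubgroup (PSL K))) ↔
      d ≠ -3 := by
  obtain ⟨e, rfl⟩ : ∃ e, d = 1 + 4 * e := ⟨(d - 1) / 4, by lia⟩
  obtain ⟨φ⟩ := nonempty_quadOrder_ringEquiv (by lia : e ≤ -1) hdsf hK2 hα
  constructor
  · rintro ⟨-, h⟩ hd3
    obtain rfl : e = -1 := by lia
    exact h ⟨⊤, top_ne_bot, sqSubgroup_eq_top φ ▸ le_top⟩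
  · intro hd3
    have h := not_isCongruence_sqSubgroup φ (by lia) (Int.odd_iff.2 (by lia))
    exact ⟨fun ⟨π, hπ, hle⟩ => h ⟨π, hπ, hle.trans (commutator_le_sqSubgroup _)⟩, h⟩
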